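/- Let (X,T) be a minimal Cantor system, μ a T-invariant Borel probability measure on X, I ⊆ X a nonempty clopen set with μ(I) > 0, r_1 < … < r_l the distinct values taken by N_I^{(1)} on I, and τ(i) = {x ∈ I : N_I^{(1)}(x) = r_i}. Then for every real t ≥ 0, μ{x ∈ X : μ(I) · N_I^{(1)}(x) ≤ t} = Σ_{i=1}^{l} min(⌊t/μ(I)⌋, r_i) · μ(τ(i)). -/

import Mathlib

open Function MeasureTheory

/-- The entrance time `N_I^{(1)}(x) = inf {n ≥ 1 : T^n x ∈ I}` (with the convention
`sInf ∅ = 0` in `ℕ`; by minimality the infimum is over a nonempty set). -/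
noncomputable def entranceTime {X : Type*} (T : X → X) (I : Set X) (x : X) : ℕ :=
  sInf {n : ℕ | 1 ≤ n ∧ T^[n] x ∈ I}

/-- In a minimal system on a compact space, every point enters a given nonempty open set in
positive time. -/
theorem exists_one_le_iterate_mem {X : Type*} [TopologicalSpace X] [CompactSpace X]
    (T : X ≃ₜ X) (hmin : ∀ x : X, Dense (Set.range fun n : ℤ => (T.toEquiv ^ n) x))
    {I : Set X} (hI : IsOpen I) (hIne : I.Nonempty) (x : X) :
    ∃ n : ℕ, 1 ≤ n ∧ T^[n] x ∈ I := by
  have hcont (n : ℤ) : Continuous (T.toEquiv ^ n : Equiv.Perm X) := by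
    have hT (m : ℕ) : Continuous (T.toEquiv ^ m : Equiv.Perm X) := by
      rw [Equiv.Perm.coe_pow]
      exact T.continuous.iterate m
    have hTinv (m : ℕ) : Continuous ((T.toEquiv ^ m)⁻¹ : Equiv.Perm X) := by
      rw [← inv_pow, Equiv.Perm.coe_pow]
      exact T.symm.continuous.iterate m
    cases n with
    | ofNat m => simpa using hT m
    | negSucc m => simpa only [zpow_negSucc] using hTinv (m + 1)
  obtain ⟨F, hF⟩ := isCompact_univ.elim_finite_subcover
    (fun n : ℤ => (T.toEquiv ^ n : Equiv.Perm X) ⁻¹' I) (fun n => hI.preimage (hcont n))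
    (fun y _ => by
      obtain ⟨_, hzI, n, rfl⟩ := (hmin y).inter_open_nonempty I hI hIne
      exact Set.mem_iUnion.2 ⟨n, hzI⟩)
  obtain ⟨b, hb⟩ := F.bddBelow
  obtain ⟨n, hnF, hn⟩ := Set.mem_iUnion₂.1 (hF (Set.mem_univ ((T.toEquiv ^ (1 - b)) x)))
  have hbn : b ≤ n := hb hnF
  refine ⟨(n + (1 - b)).toNat, by omega, ?_⟩
  have hcast : (((n + (1 - b)).toNat : ℕ) : ℤ) = n + (1 - b) := Int.toNat_of_nonneg (by omega)
  have hiter : T^[(n + (1 - b)).toNat] x = (T.toEquiv ^ (n + (1 - b))) x := by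
    rw [← hcast, zpow_natCast, Equiv.Perm.coe_pow]
    rfl
  rw [hiter, zpow_add]
  exact hn

theorem entranceTime_le_iff {X : Type*} {T : X → X} {I : Set X} {x : X}
    (h : ∃ n : ℕ, 1 ≤ n ∧ T^[n] x ∈ I) (k : ℕ) :
    entranceTime T I x ≤ k ↔ ∃ n : ℕ, n ≤ k ∧ 1 ≤ n ∧ T^[n] x ∈ I :=
  ⟨fun hk => ⟨_, hk, Nat.sInf_mem h⟩, fun ⟨_, hnk, hn⟩ => (Nat.sInf_le hn).trans hnk⟩

theorem entranceTime_le_zero {X : Type*} {T : X → X} {I : Set X}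
    (h : ∀ x, ∃ n : ℕ, 1 ≤ n ∧ T^[n] x ∈ I) :
    {x | entranceTime T I x ≤ 0} = ∅ := by
  ext x
  simp only [Set.mem_ofPred_eq, entranceTime_le_iff (h x), Set.mem_empty_iff_false, iff_false]
  rintro ⟨n, hn, hn', -⟩
  omega

theorem entranceTime_le_succ {X : Type*} {T : X → X} {I : Set X}
    (h : ∀ x, ∃ n : ℕ, 1 ≤ n ∧ T^[n] x ∈ I) (k : ℕ) :
    {x | entranceTime T I x ≤ k + 1} = T ⁻¹' ({x | entranceTime T I x ≤ k} ∪ I) := by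
  ext x
  simp only [Set.mem_preimage, Set.mem_union, Set.mem_ofPred_eq, entranceTime_le_iff (h _)]
  constructor
  · rintro ⟨n, hnk, hn, hnI⟩
    obtain ⟨m, rfl⟩ := Nat.exists_eq_add_of_le' hn
    rcases Nat.eq_zero_or_pos m with rfl | hm
    · exact Or.inr hnI
    · exact Or.inl ⟨m, by omega, hm, hnI⟩
  · rintro (⟨n, hnk, -, hnI⟩ | hxI)
    · exact ⟨n + 1, by omega, by omega, hnI⟩
    · exact ⟨1, by omega, le_rfl, hxI⟩

theorem measurable_entranceTime {X : Type*} [MeasurableSpace X] {T : X → X} {I : Set X}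
    (hT : Measurable T) (hI : MeasurableSet I) (h : ∀ x, ∃ n : ℕ, 1 ≤ n ∧ T^[n] x ∈ I) :
    Measurable (entranceTime T I) := by
  refine measurable_of_Iic fun k => ?_
  change MeasurableSet {x | entranceTime T I x ≤ k}
  induction k with
  | zero =>
    rw [entranceTime_le_zero h]
    simp
  | succ k ih =>
    rw [entranceTime_le_succ h]
    exact hT (ih.union hI)

/-- The distribution function of the entrance time, in terms of the return times. -/
theorem measure_entranceTime_le {X : Type*} [MeasurableSpace X] {T : X → X} {I : Set X}
    {μ : Measure X} (hT : MeasurePreserving T μ μ) (hI : MeasurableSet I)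
    (h : ∀ x, ∃ n : ℕ, 1 ≤ n ∧ T^[n] x ∈ I) {ι : Type*} [Fintype ι] {r : ι → ℕ}
    (hr : Injective r) (hval : ∀ x ∈ I, ∃ i, entranceTime T I x = r i) (k : ℕ) :
    μ {x | entranceTime T I x ≤ k} =
      ∑ i, ((min k (r i) : ℕ) : ENNReal) * μ {x ∈ I | entranceTime T I x = r i} := by
  have hmeas := measurable_entranceTime hT.measurable hI h
  have hle (k : ℕ) : MeasurableSet {x | entranceTime T I x ≤ k} := hmeas measurableSet_Iic
  induction k with
  | zero =>
    rw [entranceTime_le_zero h]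
    simp
  | succ k ih =>
    have hdiff : I \ {x | entranceTime T I x ≤ k} =
        ⋃ i ∈ Finset.univ.filter (fun i => k < r i), {x ∈ I | entranceTime T I x = r i} := by
      ext x
      simp only [Set.mem_sdiff, Set.mem_ofPred_eq, not_le, Finset.mem_filter, Finset.mem_univ,
        true_and, Set.mem_iUnion, exists_prop]
      constructor
      · rintro ⟨hx, hk⟩
        obtain ⟨i, hi⟩ := hval x hx
        exact ⟨i, hi ▸ hk, hx, hi⟩
      · rintro ⟨i, hk, hx, hi⟩
        exact ⟨hx, hi ▸ hk⟩
    have hτ (i : ι) : MeasurableSet {x ∈ I | entranceTime T I x = r i} :=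
      hI.inter (hmeas (measurableSet_singleton (r i)))
    rw [entranceTime_le_succ h, hT.measure_preimage ((hle k).union hI).nullMeasurableSet,
      ← Set.union_sdiff_self, measure_union Set.disjoint_sdiff_right (hI.diff (hle k)), ih, hdiff,
      measure_biUnion_finset
        (fun i _ j _ hij => Set.disjoint_left.2 fun x hi hj => hij (hr (hi.2.symm.trans hj.2)))
        (fun i _ => hτ i),
      Finset.sum_filter, ← Finset.sum_add_distrib]
    refine Finset.sum_congr rfl fun i _ => ?_
    split_ifs with hi
    · rw [min_eq_left hi.le, min_eq_left (Nat.succ_le_of_lt hi)]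
      push_cast
      ring
    · rw [min_eq_right (by omega), min_eq_right (by omega), add_zero]

/-- For a minimal Cantor system `(X,T)`, a `T`-invariant Borel probability
measure `μ`, a nonempty clopen `I` with `μ(I) > 0`, and `r 1 < … < r l` the distinct
values of the entrance time on `I` with level sets `τ i`, for every real `t ≥ 0`:
`μ {x : μ(I)·N_I^{(1)} x ≤ t} = Σ_i min(⌊t/μ(I)⌋, r i) · μ (τ i)`. -/
theorem stmt_5 {X : Type*} [TopologicalSpace X] [CompactSpace X] [Nonempty X]
    [TopologicalSpace.MetrizableSpace X] [TotallyDisconnectedSpace X] [PerfectSpace X]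
    [MeasurableSpace X] [BorelSpace X]
    (T : X ≃ₜ X)
    (hmin : ∀ x : X, Dense (Set.range fun n : ℤ => (T.toEquiv ^ n) x))
    (μ : Measure X) [IsProbabilityMeasure μ]
    (hinv : ∀ A : Set X, MeasurableSet A → μ ((⇑T) ⁻¹' A) = μ A)
    (I : Set X) (hI : IsClopen I) (hIne : I.Nonempty) (hIpos : 0 < μ I)
    (l : ℕ) (r : Fin l → ℕ) (hr : StrictMono r)
    (hval : ∀ x ∈ I, ∃ i : Fin l, entranceTime (⇑T) I x = r i)
    (hall : ∀ i : Fin l, ∃ x ∈ I, entranceTime (⇑T) I x = r i)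
    (τ : Fin l → Set X)
    (hτ : ∀ i : Fin l, τ i = {x ∈ I | entranceTime (⇑T) I x = r i}) :
    ∀ t : ℝ, 0 ≤ t →
      μ {x : X | (μ I).toReal * (entranceTime (⇑T) I x : ℝ) ≤ t} =
        ∑ i : Fin l, ((min (Nat.floor (t / (μ I).toReal)) (r i) : ℕ) : ENNReal) * μ (τ i) := by
  intro t ht
  have hpos : 0 < (μ I).toReal := ENNReal.toReal_pos hIpos.ne' (measure_ne_top μ I)
  have hT : MeasurePreserving T μ μ :=
    ⟨T.continuous.measurable, Measure.ext fun A hA => by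
      rw [Measure.map_apply T.continuous.measurable hA, hinv A hA]⟩
  have hset : {x : X | (μ I).toReal * (entranceTime (⇑T) I x : ℝ) ≤ t} =
      {x | entranceTime (⇑T) I x ≤ Nat.floor (t / (μ I).toReal)} := by
    ext x
    rw [Set.mem_ofPred_eq, Set.mem_ofPred_eq, Nat.le_floor_iff (div_nonneg ht hpos.le),
      le_div_iff₀' hpos]
  simp only [hset, hτ]
  exact measure_entranceTime_le hT hI.isOpen.measurableSet
    (exists_one_le_iterate_mem T hmin hI.isOpen hIne) hr.injective hval _
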